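/- In the uplink pilot model, the covariance of the projected pilot observation satisfies E[y_mk · y_mk^H] = pτ Σ_{l∈P_k} R_ml + I_L. -/

import Mathlib

open MeasureTheory ProbabilityTheory Matrix
open scoped ComplexOrder

/-- The standard complex Gaussian measure `CN(0,1)` on `ℂ`:
the law of `(a + i b)/√2` with `a, b` independent standard real Gaussians. -/
noncomputable def stdCGauss : Measure ℂ :=
  Measure.map (fun p : ℝ × ℝ => ((p.1 : ℂ) + (p.2 : ℂ) * Complex.I) / (Real.sqrt 2 : ℂ))
    ((gaussianReal 0 1).prod (gaussianReal 0 1))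

/-- The law of a standard complex Gaussian random vector with i.i.d. `CN(0,1)` coordinates. -/
noncomputable def stdCGaussPi (ι : Type) [Fintype ι] : Measure (ι → ℂ) :=
  Measure.pi fun _ => stdCGauss

/-- The law of a standard complex Gaussian random matrix with i.i.d. `CN(0,1)` entries. -/
noncomputable def stdCGaussMat (ι κ : Type) [Fintype ι] [Fintype κ] : Measure (ι → κ → ℂ) :=
  Measure.pi fun _ => stdCGaussPi κ

/-- Entrywise expectation of a random complex matrix. -/
noncomputable def matExp {Ω n m : Type} [MeasurableSpace Ω] (μ : Measure Ω)
    (X : Ω → Matrix n m ℂ) : Matrix n m ℂ :=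
  Matrix.of fun i j => ∫ ω, X ω i j ∂μ

/-- The AP–RIS channel matrix `W = √β̃ · R_RIS^{1/2} D R_AP^{1/2}` (with `S = R^{1/2}`). -/
noncomputable def Wmat {N L : ℕ} (βm : ℝ) (SRISm : Matrix (Fin N) (Fin N) ℂ)
    (SAP : Matrix (Fin L) (Fin L) ℂ) (Dω : Fin N → Fin L → ℂ) :
    Matrix (Fin N) (Fin L) ℂ :=
  (Real.sqrt βm : ℂ) • (SRISm * Matrix.of Dω * SAP)

/-- The RIS–UE channel vector `q = √β̃ · R_RIS^{1/2} c` (with `S = R^{1/2}`). -/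
noncomputable def qVec {N : ℕ} (βu : ℝ) (SRISu : Matrix (Fin N) (Fin N) ℂ)
    (cω : Fin N → ℂ) : Fin N → ℂ :=
  (Real.sqrt βu : ℂ) • (SRISu *ᵥ cω)

/-- The cascaded channel `h = Wᴴ Φ q`. -/
noncomputable def hChan {N L : ℕ} (βm : ℝ) (SRISm : Matrix (Fin N) (Fin N) ℂ)
    (SAP : Matrix (Fin L) (Fin L) ℂ) (Φ : Matrix (Fin N) (Fin N) ℂ)
    (βu : ℝ) (SRISu : Matrix (Fin N) (Fin N) ℂ)
    (Dω : Fin N → Fin L → ℂ) (cω : Fin N → ℂ) : Fin L → ℂ :=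
  (Wmat βm SRISm SAP Dω)ᴴ *ᵥ (Φ *ᵥ qVec βu SRISu cω)

/-- `R̃ = β̃_m β̃_u · R_RIS,m Φ R_RIS,u Φᴴ`. -/
noncomputable def Rtil {N : ℕ} (βm βu : ℝ) (RRISm Φ RRISu : Matrix (Fin N) (Fin N) ℂ) :
    Matrix (Fin N) (Fin N) ℂ :=
  ((βm * βu : ℝ) : ℂ) • (RRISm * Φ * RRISu * Φᴴ)

/-- A family of measurable complex random variables that is square integrable, centred and
orthonormal in `L²`. -/
structure IsWhite {Ω J : Type} [MeasurableSpace Ω] [DecidableEq J] (μ : Measure Ω)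
    (X : J → Ω → ℂ) : Prop where
  measurable : ∀ j, Measurable (X j)
  memLp : ∀ j, MemLp (X j) 2 μ
  mean : ∀ j, ∫ ω, X j ω ∂μ = 0
  inner : ∀ i j, ∫ ω, X i ω * star (X j ω) ∂μ = if i = j then 1 else 0

namespace IsWhite

variable {Ω Ω' J J' : Type} [MeasurableSpace Ω] [MeasurableSpace Ω'] [DecidableEq J]
  [DecidableEq J'] {μ : Measure Ω} {ν : Measure Ω'}

lemma measurable_star {X : J → Ω → ℂ} (hX : IsWhite μ X) (j : J) :
    Measurable (fun ω => star (X j ω)) :=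
  continuous_star.measurable.comp (hX.measurable j)

lemma comp_injective {X : J → Ω → ℂ} (hX : IsWhite μ X) {f : J' → J}
    (hf : Function.Injective f) : IsWhite μ (fun j => X (f j)) where
  measurable j := hX.measurable _
  memLp j := hX.memLp _
  mean j := hX.mean _
  inner i j := by rw [hX.inner]; simp only [hf.eq_iff]

lemma comp_measurePreserving {X : J → Ω' → ℂ} (hX : IsWhite ν X) {g : Ω → Ω'}
    (hg : MeasurePreserving g μ ν) : IsWhite μ (fun j ω => X j (g ω)) where
  measurable j := (hX.measurable j).comp hg.measurable
  memLp j := (hX.memLp j).comp_measurePreserving hg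
  mean j := by
    rw [← hX.mean j, ← hg.map_eq,
      integral_map hg.aemeasurable (hX.measurable j).aestronglyMeasurable]
  inner i j := by
    rw [← hX.inner i j, ← hg.map_eq, integral_map hg.aemeasurable]
    exact ((hX.measurable i).mul (hX.measurable_star j)).aestronglyMeasurable

lemma integrable_mul_star {X : J → Ω → ℂ} (hX : IsWhite μ X) (i j : J) :
    Integrable (fun ω => X i ω * star (X j ω)) μ :=
  (hX.memLp i).integrable_mul (hX.memLp j).star

/-- Independent copies of a white family, one for each coordinate, form a white family. -/
lemma pi [IsProbabilityMeasure μ] {ι : Type} [Fintype ι] [DecidableEq ι] {X : J → Ω → ℂ}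
    (hX : IsWhite μ X) :
    IsWhite (Measure.pi fun _ : ι => μ) (fun (q : ι × J) ω => X q.2 (ω q.1)) := by
  have coord (i : ι) : IsWhite (Measure.pi fun _ : ι => μ) (fun j ω => X j (ω i)) :=
    hX.comp_measurePreserving (measurePreserving_eval _ i)
  refine ⟨fun q => (coord q.1).measurable q.2, fun q => (coord q.1).memLp q.2,
    fun q => (coord q.1).mean q.2, ?_⟩
  rintro ⟨i, j⟩ ⟨i', j'⟩
  by_cases h : i = i'
  · subst h
    simpa using (coord i).inner j j'
  · have hind : IndepFun (fun ω : ι → Ω => ω i) (fun ω => ω i') (Measure.pi fun _ => μ) :=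
      (iIndepFun_pi (μ := fun _ : ι => μ) (X := fun _ => id)
        fun _ => aemeasurable_id).indepFun h
    have hind' := hind.comp (hX.measurable j) (hX.measurable_star j')
    have := hind'.integral_mul_eq_mul_integral
      ((coord i).memLp j).aestronglyMeasurable ((coord i').memLp j').star.aestronglyMeasurable
    have h0 := (coord i).mean j
    simp only [Prod.mk.injEq, h, false_and, if_false]
    refine this.trans ?_
    exact mul_eq_zero_of_left h0 _

lemma memLp_mul_prod [SFinite μ] [SFinite ν] {f : Ω → ℂ} {g : Ω' → ℂ} (hf : MemLp f 2 μ)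
    (hg : MemLp g 2 ν) : MemLp (fun ω : Ω × Ω' => f ω.1 * g ω.2) 2 (μ.prod ν) := by
  have hmeas : AEStronglyMeasurable (fun ω : Ω × Ω' => f ω.1 * g ω.2) (μ.prod ν) :=
    hf.aestronglyMeasurable.comp_fst.mul hg.aestronglyMeasurable.comp_snd
  rw [memLp_two_iff_integrable_sq_norm hmeas]
  simp only [norm_mul, mul_pow]
  exact ((memLp_two_iff_integrable_sq_norm hf.1).1 hf).mul_prod
    ((memLp_two_iff_integrable_sq_norm hg.1).1 hg)

lemma star_mul_prod [SFinite μ] [SFinite ν] {X : J → Ω → ℂ} {Y : J' → Ω' → ℂ}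
    (hX : IsWhite μ X) (hY : IsWhite ν Y) :
    IsWhite (μ.prod ν) (fun (q : J × J') ω => star (X q.1 ω.1) * Y q.2 ω.2) where
  measurable q := ((hX.measurable_star q.1).comp measurable_fst).mul
    ((hY.measurable q.2).comp measurable_snd)
  memLp q := memLp_mul_prod (hX.memLp q.1).star (hY.memLp q.2)
  mean q := by
    rw [integral_prod_mul (fun ω => star (X q.1 ω)) (Y q.2), hY.mean, mul_zero]
  inner q r := by
    have h := integral_prod_mul (μ := μ) (ν := ν) (fun ω => X r.1 ω * star (X q.1 ω))
      (fun ω => Y q.2 ω * star (Y r.2 ω))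
    rw [hX.inner, hY.inner] at h
    calc _ = _ := integral_congr_ae (.of_forall fun ω => by simp only [star_mul', star_star]; ring)
      _ = _ := h
      _ = _ := by
        simp only [Prod.ext_iff, eq_comm (a := r.1)]
        split_ifs <;> simp_all

lemma sumElim_prod [IsProbabilityMeasure μ] [IsProbabilityMeasure ν] {X : J → Ω → ℂ}
    {Y : J' → Ω' → ℂ} (hX : IsWhite μ X) (hY : IsWhite ν Y) :
    IsWhite (μ.prod ν) (Sum.elim (fun j ω => X j ω.1) (fun j ω => Y j ω.2)) := by
  have h1 : IsWhite (μ.prod ν) (fun j ω => X j ω.1) :=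
    hX.comp_measurePreserving measurePreserving_fst
  have h2 : IsWhite (μ.prod ν) (fun j ω => Y j ω.2) :=
    hY.comp_measurePreserving measurePreserving_snd
  refine ⟨?_, ?_, ?_, ?_⟩
  · rintro (j | j)
    exacts [h1.measurable j, h2.measurable j]
  · rintro (j | j)
    exacts [h1.memLp j, h2.memLp j]
  · rintro (j | j)
    exacts [h1.mean j, h2.mean j]
  · rintro (i | i) (j | j)
    · simpa using h1.inner i j
    · simpa [hX.mean] using integral_prod_mul (μ := μ) (ν := ν) (X i) (fun ω => star (Y j ω))
    · simpa [hX.mean, hY.mean, mul_comm] using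
        integral_prod_mul (μ := μ) (ν := ν) (fun ω => star (X j ω)) (Y i)
    · simpa using h2.inner i j

/-- The covariance matrix of a linear image `A X` of a white vector `X` is `A Aᴴ`. -/
lemma matExp_vecMulVec_mulVec [Fintype J] {n : Type} {X : J → Ω → ℂ} (hX : IsWhite μ X)
    (A : Matrix n J ℂ) :
    matExp μ (fun ω => vecMulVec (A *ᵥ fun j => X j ω) (star (A *ᵥ fun j => X j ω)))
      = A * Aᴴ := by
  ext i i'
  have expand (ω : Ω) : (A *ᵥ fun j => X j ω) i * star ((A *ᵥ fun j => X j ω) i')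
      = ∑ j, ∑ j', A i j * star (A i' j') * (X j ω * star (X j' ω)) := by
    simp only [mulVec, dotProduct, star_sum, Finset.sum_mul_sum, star_mul']
    exact Finset.sum_congr rfl fun _ _ => Finset.sum_congr rfl fun _ _ => by ring
  simp only [matExp, of_apply, vecMulVec_apply, Pi.star_apply, expand]
  rw [integral_finsetSum _ fun j _ => integrable_finsetSum _ fun j' _ =>
    (hX.integrable_mul_star j j').const_mul _]
  simp_rw [integral_finsetSum _ fun j' _ => (hX.integrable_mul_star _ j').const_mul _,
    integral_const_mul, hX.inner]
  simp [mul_apply]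

end IsWhite

instance : IsProbabilityMeasure stdCGauss :=
  Measure.isProbabilityMeasure_map (by fun_prop)

instance (ι : Type) [Fintype ι] : IsProbabilityMeasure (stdCGaussPi ι) := by
  unfold stdCGaussPi; infer_instance

instance (ι κ : Type) [Fintype ι] [Fintype κ] : IsProbabilityMeasure (stdCGaussMat ι κ) := by
  unfold stdCGaussMat; infer_instance

lemma isWhite_stdCGauss : IsWhite stdCGauss (fun (_ : Unit) w => w) := by
  have hg : Measurable
      (fun p : ℝ × ℝ => ((p.1 : ℂ) + (p.2 : ℂ) * Complex.I) / (Real.sqrt 2 : ℂ)) := by fun_prop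
  have hid : MemLp (fun x : ℝ => x) 2 (gaussianReal 0 1) := memLp_id_gaussianReal 2
  have hfst : MemLp (fun p : ℝ × ℝ => p.1) 2 ((gaussianReal 0 1).prod (gaussianReal 0 1)) :=
    hid.comp_measurePreserving measurePreserving_fst
  have hsnd : MemLp (fun p : ℝ × ℝ => p.2) 2 ((gaussianReal 0 1).prod (gaussianReal 0 1)) :=
    hid.comp_measurePreserving measurePreserving_snd
  have hsq : ∫ x, x ^ 2 ∂(gaussianReal 0 1) = 1 := by
    have h := variance_eq_integral (μ := gaussianReal 0 1) (X := fun x : ℝ => x) (by fun_prop)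
    simpa using h.symm
  have hmem : MemLp (fun p : ℝ × ℝ => ((p.1 : ℂ) + (p.2 : ℂ) * Complex.I) / (Real.sqrt 2 : ℂ)) 2
      ((gaussianReal 0 1).prod (gaussianReal 0 1)) := by
    simp only [div_eq_mul_inv]
    exact ((hfst.ofReal (K := ℂ)).add ((hsnd.ofReal (K := ℂ)).mul_const Complex.I)).mul_const
      (Real.sqrt 2 : ℂ)⁻¹
  refine ⟨fun _ => measurable_id, fun _ => ?_, fun _ => ?_, fun _ _ => ?_⟩
  · exact (memLp_map_measure_iff measurable_id.aestronglyMeasurable hg.aemeasurable).2 hmem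
  · rw [stdCGauss, integral_map (f := fun w : ℂ => w) hg.aemeasurable (by fun_prop),
      integral_div, integral_add (hfst.integrable (by norm_num)).ofReal
        ((hsnd.integrable (by norm_num)).ofReal.mul_const _), integral_mul_const,
      integral_complex_ofReal, integral_complex_ofReal, integral_fun_fst (fun x : ℝ => x),
      integral_fun_snd (fun x : ℝ => x)]
    simp
  · have hnorm (p : ℝ × ℝ) : ((p.1 : ℂ) + (p.2 : ℂ) * Complex.I) / (Real.sqrt 2 : ℂ) *
        star (((p.1 : ℂ) + (p.2 : ℂ) * Complex.I) / (Real.sqrt 2 : ℂ))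
        = (((p.1 ^ 2 + p.2 ^ 2) / 2 : ℝ) : ℂ) := by
      have h2 : (Real.sqrt 2 : ℂ) * (Real.sqrt 2 : ℂ) = 2 := by
        rw [← Complex.ofReal_mul, Real.mul_self_sqrt (by norm_num)]; simp
      simp only [star_div₀, star_add, star_mul', Complex.star_def, Complex.conj_ofReal,
        Complex.conj_I]
      rw [div_mul_div_comm, h2]
      push_cast
      linear_combination (-(p.2 : ℂ) ^ 2 / 2) * Complex.I_sq
    rw [stdCGauss, integral_map hg.aemeasurable (by fun_prop)]
    simp_rw [hnorm]
    rw [integral_complex_ofReal, integral_div, integral_add hfst.integrable_sq hsnd.integrable_sq,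
      integral_fun_fst (fun x : ℝ => x ^ 2), integral_fun_snd (fun x : ℝ => x ^ 2), hsq]
    simp

lemma isWhite_stdCGaussPi (ι : Type) [Fintype ι] [DecidableEq ι] :
    IsWhite (stdCGaussPi ι) (fun i w => w i) :=
  isWhite_stdCGauss.pi.comp_injective (f := fun i : ι => (i, ())) fun _ _ h => by simpa using h

lemma isWhite_stdCGaussMat (ι κ : Type) [Fintype ι] [Fintype κ] [DecidableEq ι] [DecidableEq κ] :
    IsWhite (stdCGaussMat ι κ) (fun (q : ι × κ) w => w q.1 q.2) :=
  (isWhite_stdCGaussPi κ).pi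

/-- The products `D̄ₐᵦ cₗₑ` together with the noise entries form a white family. -/
lemma isWhite_sources (ι κ K κ' : Type) [Fintype ι] [Fintype κ] [Fintype K] [Fintype κ']
    [DecidableEq ι] [DecidableEq κ] [DecidableEq K] [DecidableEq κ'] :
    IsWhite ((stdCGaussMat ι κ).prod ((stdCGaussMat K ι).prod (stdCGaussPi κ')))
      (Sum.elim (fun (q : (ι × κ) × (K × ι)) w => star (w.1 q.1.1 q.1.2) * w.2.1 q.2.1 q.2.2)
        (fun j w => w.2.2 j)) := by
  have h := (((isWhite_stdCGaussMat ι κ).star_mul_prod (isWhite_stdCGaussMat K ι)).sumElim_prod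
    (isWhite_stdCGaussPi κ')).comp_measurePreserving
      ((measurePreserving_prodAssoc _ _ _).symm MeasurableEquiv.prodAssoc)
  convert h using 1
  funext j w
  rcases j with j | j <;> rfl

/-- The UE-side matrix `B` of the bilinear form `h = S_APᴴ Dᴴ B c`. -/
noncomputable def ueMat {N : ℕ} (βm βu : ℝ) (SRISm Φ SRISu : Matrix (Fin N) (Fin N) ℂ) :
    Matrix (Fin N) (Fin N) ℂ :=
  ((Real.sqrt βm : ℂ) * (Real.sqrt βu : ℂ)) • (SRISmᴴ * Φ * SRISu)

lemma hChan_eq {N L : ℕ} (βm βu : ℝ) (SRISm Φ SRISu : Matrix (Fin N) (Fin N) ℂ)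
    (SAP : Matrix (Fin L) (Fin L) ℂ) (Dω : Fin N → Fin L → ℂ) (cω : Fin N → ℂ) :
    hChan βm SRISm SAP Φ βu SRISu Dω cω
      = (SAPᴴ * (of Dω)ᴴ * ueMat βm βu SRISm Φ SRISu) *ᵥ cω := by
  simp only [hChan, Wmat, qVec, ueMat, conjTranspose_smul, conjTranspose_mul, mulVec_smul,
    smul_mulVec, mulVec_mulVec, Matrix.mul_smul, Matrix.smul_mul, Matrix.mul_assoc,
    Complex.star_def, Complex.conj_ofReal, smul_smul, mul_comm]

lemma trace_ueMat_mul_conjTranspose {N : ℕ} {βm βu : ℝ} (hβm : 0 ≤ βm) (hβu : 0 ≤ βu)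
    {SRISm SRISu : Matrix (Fin N) (Fin N) ℂ} (Φ : Matrix (Fin N) (Fin N) ℂ)
    (hm : SRISm.IsHermitian) (hu : SRISu.IsHermitian) :
    (ueMat βm βu SRISm Φ SRISu * (ueMat βm βu SRISm Φ SRISu)ᴴ).trace
      = (Rtil βm βu (SRISm * SRISm) Φ (SRISu * SRISu)).trace := by
  have hs : (Real.sqrt βm : ℂ) * (Real.sqrt βu : ℂ) * ((Real.sqrt βm : ℂ) * (Real.sqrt βu : ℂ))
      = ((βm * βu : ℝ) : ℂ) := by
    norm_cast
    rw [mul_mul_mul_comm, Real.mul_self_sqrt hβm, Real.mul_self_sqrt hβu]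
  simp only [ueMat, Rtil, conjTranspose_smul, conjTranspose_mul,
    hm.eq, hu.eq, star_mul', Complex.star_def, Complex.conj_ofReal, Matrix.smul_mul,
    Matrix.mul_smul, smul_smul, trace_smul, hs]
  congr 1
  rw [← Matrix.mul_assoc, ← Matrix.mul_assoc, trace_mul_comm]
  simp only [Matrix.mul_assoc]

lemma trace_mul_conjTranspose_eq_sum {n : Type} [Fintype n] (B : Matrix n n ℂ) :
    (B * Bᴴ).trace = ∑ a, ∑ e, B a e * star (B a e) := by
  simp [trace, mul_apply]

/-- The matrix expressing the pilot observation through the white sources. -/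
noncomputable def pilotMat {N L : ℕ} {K : Type} [DecidableEq K] (s : ℂ) (Pk : Finset K)
    (A : Matrix (Fin L) (Fin L) ℂ) (B : K → Matrix (Fin N) (Fin N) ℂ) :
    Matrix (Fin L) (((Fin N × Fin L) × (K × Fin N)) ⊕ Fin L) ℂ :=
  of fun i => Sum.elim
    (fun q => if q.2.1 ∈ Pk then s * (A i q.1.2 * B q.2.1 q.1.1 q.2.2) else 0)
    (fun j => (1 : Matrix (Fin L) (Fin L) ℂ) i j)

lemma pilotMat_mulVec {N L : ℕ} {K : Type} [Fintype K] [DecidableEq K] (s : ℂ) (Pk : Finset K)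
    (A : Matrix (Fin L) (Fin L) ℂ) (B : K → Matrix (Fin N) (Fin N) ℂ)
    (d : Fin N → Fin L → ℂ) (c : K → Fin N → ℂ) (z : Fin L → ℂ) :
    pilotMat s Pk A B *ᵥ (Sum.elim (fun q => star (d q.1.1 q.1.2) * c q.2.1 q.2.2) z)
      = s • (∑ l ∈ Pk, (A * (of d)ᴴ * B l) *ᵥ c l) + z := by
  ext i
  have hl (l : K) : ((A * (of d)ᴴ * B l) *ᵥ c l) i
      = ∑ a, ∑ b, ∑ e, A i b * B l a e * (star (d a b) * c l e) := by
    simp only [mulVec, dotProduct, mul_apply, conjTranspose_apply, of_apply, Finset.sum_mul]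
    rw [Finset.sum_comm]
    refine Finset.sum_congr rfl fun a _ => ?_
    rw [Finset.sum_comm]
    exact Finset.sum_congr rfl fun _ _ => Finset.sum_congr rfl fun _ _ => by ring
  have hz : ∑ j, (1 : Matrix (Fin L) (Fin L) ℂ) i j * z j = z i := by
    simp [one_apply]
  simp only [Pi.add_apply, Pi.smul_apply, Finset.sum_apply, hl, smul_eq_mul]
  simp only [mulVec, dotProduct, pilotMat, of_apply, Fintype.sum_sum_type, Sum.elim_inl,
    Sum.elim_inr, hz, Fintype.sum_prod_type, ite_mul, zero_mul]
  congr 1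
  simp only [Finset.sum_comm (s := (Finset.univ : Finset (Fin L))) (t := (Finset.univ : Finset K)),
    Finset.sum_comm (s := (Finset.univ : Finset (Fin N))) (t := (Finset.univ : Finset K)),
    Finset.mul_sum]
  rw [← Finset.sum_subset (Finset.subset_univ Pk) fun l _ hl => by simp [hl]]
  refine Finset.sum_congr rfl fun l hl => ?_
  simp only [hl, if_true, mul_assoc]

lemma pilotMat_mul_conjTranspose {N L : ℕ} {K : Type} [Fintype K] [DecidableEq K] (s : ℂ)
    (Pk : Finset K) (A : Matrix (Fin L) (Fin L) ℂ) (B : K → Matrix (Fin N) (Fin N) ℂ) :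
    pilotMat s Pk A B * (pilotMat s Pk A B)ᴴ
      = (s * star s) • (∑ l ∈ Pk, (B l * (B l)ᴴ).trace • (A * Aᴴ)) + 1 := by
  ext i i'
  have hone : ∑ j, (1 : Matrix (Fin L) (Fin L) ℂ) i j * star ((1 : Matrix (Fin L) (Fin L) ℂ) i' j)
      = (1 : Matrix (Fin L) (Fin L) ℂ) i i' := by
    simp [one_apply]
  simp only [mul_apply, conjTranspose_apply, pilotMat, of_apply, Fintype.sum_sum_type,
    Sum.elim_inl, Sum.elim_inr, hone, Fintype.sum_prod_type, Matrix.add_apply, Matrix.smul_apply,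
    Matrix.sum_apply, smul_eq_mul, trace_mul_conjTranspose_eq_sum]
  congr 1
  simp only [Finset.sum_comm (s := (Finset.univ : Finset (Fin L))) (t := (Finset.univ : Finset K)),
    Finset.sum_comm (s := (Finset.univ : Finset (Fin N))) (t := (Finset.univ : Finset K)),
    Finset.mul_sum, Finset.sum_mul]
  rw [← Finset.sum_subset (Finset.subset_univ Pk) fun l _ hl => by simp [hl]]
  refine Finset.sum_congr rfl fun l hl => ?_
  rw [Finset.sum_comm]
  refine Finset.sum_congr rfl fun b _ => Finset.sum_congr rfl fun a _ =>
    Finset.sum_congr rfl fun e _ => ?_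
  simp only [hl, if_true, star_mul']
  ring

/-- In the uplink pilot model,
`E[y_mk y_mkᴴ] = pτ Σ_{l∈P_k} R_ml + I_L`. -/
theorem pilot_observation_covariance
    {Ω : Type} [MeasurableSpace Ω] (μ : Measure Ω) [IsProbabilityMeasure μ]
    (N L : ℕ) (K : Type) [Fintype K]
    -- AP-side statistics: path loss and PSD correlation matrices with their PSD square roots
    (βm : ℝ) (hβm : 0 < βm)
    (SRISm RRISm : Matrix (Fin N) (Fin N) ℂ)
    (hSRISm : SRISm.PosSemidef) (hRRISm : SRISm * SRISm = RRISm)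
    (SAP RAP : Matrix (Fin L) (Fin L) ℂ)
    (hSAP : SAP.PosSemidef) (hRAP : SAP * SAP = RAP)
    -- UE-side statistics
    (βu : K → ℝ) (hβu : ∀ l, 0 < βu l)
    (SRISu RRISu : K → Matrix (Fin N) (Fin N) ℂ)
    (hSRISu : ∀ l, (SRISu l).PosSemidef) (hRRISu : ∀ l, SRISu l * SRISu l = RRISu l)
    (Φ : K → Matrix (Fin N) (Fin N) ℂ)
    -- random sources: mutually independent standard complex Gaussians
    (D : Ω → Fin N → Fin L → ℂ) (c : K → Ω → Fin N → ℂ) (z : Ω → Fin L → ℂ)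
    (hD : Measurable D) (hc : ∀ l, Measurable (c l)) (hz : Measurable z)
    (hlaw : μ.map (fun ω => (D ω, fun l => c l ω, z ω))
      = (stdCGaussMat (Fin N) (Fin L)).prod
          ((stdCGaussMat K (Fin N)).prod (stdCGaussPi (Fin L))))
    -- pilot parameters
    (p τ : ℝ) (hp : 0 < p) (hτ : 0 < τ)
    (Pk : Finset K) (k : K) (hk : k ∈ Pk)
    -- the cascaded channels, their covariance matrices, and the pilot observation
    (h : K → Ω → Fin L → ℂ)
    (hh : ∀ l ω, h l ω = hChan βm SRISm SAP (Φ l) (βu l) (SRISu l) (D ω) (c l ω))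
    (Rm : K → Matrix (Fin L) (Fin L) ℂ)
    (hRm : ∀ l, Rm l = (Rtil βm (βu l) RRISm (Φ l) (RRISu l)).trace • RAP)
    (y : Ω → Fin L → ℂ)
    (hy : ∀ ω, y ω = (Real.sqrt (p * τ) : ℂ) • (∑ l ∈ Pk, h l ω) + z ω)
    :
    matExp μ (fun ω => Matrix.vecMulVec (y ω) (star (y ω)))
      = ((p * τ : ℝ) : ℂ) • (∑ l ∈ Pk, Rm l) + 1 := by
  classical
  have hX := (isWhite_sources (Fin N) (Fin L) K (Fin L)).comp_measurePreserving
    (⟨hD.prodMk ((measurable_pi_lambda _ hc).prodMk hz), hlaw⟩ : MeasurePreserving _ μ _)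
  set B : K → Matrix (Fin N) (Fin N) ℂ := fun l => ueMat βm (βu l) SRISm (Φ l) (SRISu l) with hB
  have hyX (ω : Ω) : y ω = pilotMat (Real.sqrt (p * τ) : ℂ) Pk SAPᴴ B *ᵥ
      (Sum.elim (fun q => star (D ω q.1.1 q.1.2) * c q.2.1 ω q.2.2) (z ω)) := by
    rw [pilotMat_mulVec (d := D ω) (c := fun l => c l ω), hy]
    simp only [hh, hChan_eq, hB]
  have key := hX.matExp_vecMulVec_mulVec (pilotMat (Real.sqrt (p * τ) : ℂ) Pk SAPᴴ B)
  rw [pilotMat_mul_conjTranspose] at key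
  have hs : (Real.sqrt (p * τ) : ℂ) * star (Real.sqrt (p * τ) : ℂ) = ((p * τ : ℝ) : ℂ) := by
    rw [Complex.star_def, Complex.conj_ofReal, ← Complex.ofReal_mul,
      Real.mul_self_sqrt (mul_pos hp hτ).le]
  have hR (l : K) : (B l * (B l)ᴴ).trace • (SAPᴴ * SAPᴴᴴ) = Rm l := by
    rw [hRm, hB, trace_ueMat_mul_conjTranspose hβm.le (hβu l).le _ hSRISm.1 (hSRISu l).1,
      hRRISm, hRRISu, conjTranspose_conjTranspose, hSAP.1.eq, hRAP]
  simp only [hs, hR] at key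
  rw [← key]
  congr 1
  funext ω
  have hv : (fun j => Sum.elim
      (fun (q : (Fin N × Fin L) × (K × Fin N))
        (w : (Fin N → Fin L → ℂ) × (K → Fin N → ℂ) × (Fin L → ℂ)) =>
        star (w.1 q.1.1 q.1.2) * w.2.1 q.2.1 q.2.2)
      (fun j w => w.2.2 j) j (D ω, fun l => c l ω, z ω))
      = Sum.elim (fun q => star (D ω q.1.1 q.1.2) * c q.2.1 ω q.2.2) (z ω) := by
    funext j
    rcases j with j | j <;> rfl
  rw [hv, ← hyX]
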